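/- Let p ≥ 2 be an integer, α ∈ (1,2), and n ≥ p+1. Then the correction matrix R_n^{p,α} = n^{-α} A_n^{p,α} - T_{n+p-2}(f^{p,α}) has rank at most 4(p-1). -/

import Mathlib

open MeasureTheory

/-- `sin x / x` with value 1 at 0. -/
noncomputable def sincf (x : ℝ) : ℝ := if x = 0 then 1 else Real.sin x / x

/-- The symbol `f^{p,α}`. -/
noncomputable def fSymbol (p : ℕ) (α : ℝ) (θ : ℝ) : ℝ :=
  ∑' l : ℤ, |θ + 2 * (l : ℝ) * Real.pi| ^ α * sincf (θ / 2 + (l : ℝ) * Real.pi) ^ (p + 1)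

/-- Open uniform knot sequence on [0,1]. -/
noncomputable def knot (p n : ℕ) (i : ℕ) : ℝ :=
  if i ≤ p + 1 then 0 else if n + p + 1 ≤ i then 1 else ((i : ℝ) - ((p : ℝ) + 1)) / n

/-- B-splines of degree `k` (Cox–de Boor recurrence) on the above knots. -/
noncomputable def bspline (p n : ℕ) : ℕ → ℕ → ℝ → ℝ
  | 0, i, x => if knot p n i ≤ x ∧ x < knot p n (i + 1) then 1 else 0
  | (k + 1), i, x =>
      (if knot p n (i + k + 1) = knot p n i then 0
        else (x - knot p n i) / (knot p n (i + k + 1) - knot p n i) * bspline p n k i x)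
      + (if knot p n (i + k + 2) = knot p n (i + 1) then 0
        else (knot p n (i + k + 2) - x) / (knot p n (i + k + 2) - knot p n (i + 1))
              * bspline p n k (i + 1) x)

/-- Greville abscissae. -/
noncomputable def greville (p n : ℕ) (i : ℕ) : ℝ :=
  (∑ j ∈ Finset.range p, knot p n (i + 1 + j)) / p

/-- Left Riemann–Liouville fractional derivative on `[0,1]`, `α ∈ (1,2)`. -/
noncomputable def RLD0x (α : ℝ) (u : ℝ → ℝ) (x : ℝ) : ℝ :=
  (1 / Real.Gamma (2 - α)) *
    deriv (deriv (fun z => ∫ y in (0:ℝ)..z, (z - y) ^ (1 - α) * u y)) x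

/-- Right Riemann–Liouville fractional derivative on `[0,1]`, `α ∈ (1,2)`. -/
noncomputable def RLDx1 (α : ℝ) (u : ℝ → ℝ) (x : ℝ) : ℝ :=
  (1 / Real.Gamma (2 - α)) *
    deriv (deriv (fun z => ∫ y in z..(1:ℝ), (y - z) ^ (1 - α) * u y)) x

/-- Collocation matrix `A_n^L`. -/
noncomputable def ALmat (p n : ℕ) (α : ℝ) : Matrix (Fin (n + p - 2)) (Fin (n + p - 2)) ℝ :=
  Matrix.of fun i j => RLD0x α (bspline p n p ((j : ℕ) + 2)) (greville p n ((i : ℕ) + 2))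

/-- Collocation matrix `A_n^R`. -/
noncomputable def ARmat (p n : ℕ) (α : ℝ) : Matrix (Fin (n + p - 2)) (Fin (n + p - 2)) ℝ :=
  Matrix.of fun i j => RLDx1 α (bspline p n p ((j : ℕ) + 2)) (greville p n ((i : ℕ) + 2))

/-- Full collocation matrix `A_n^{p,α}`. -/
noncomputable def Amat (p n : ℕ) (α : ℝ) : Matrix (Fin (n + p - 2)) (Fin (n + p - 2)) ℝ :=
  (1 / (2 * Real.cos (Real.pi * α / 2))) • (ALmat p n α + ARmat p n α)

/-- Fourier coefficient `g_k = (1/2π) ∫_{-π}^{π} g(θ) e^{-ikθ} dθ`. -/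
noncomputable def fourierCoeffSym (g : ℝ → ℝ) (k : ℤ) : ℂ :=
  ((1 / (2 * Real.pi) : ℝ) : ℂ) *
    ∫ θ in (-Real.pi)..Real.pi, (g θ : ℂ) * Complex.exp (-(Complex.I * (k : ℂ) * (θ : ℂ)))

/-- Toeplitz matrix `T_N(g)` (real entries, `g` real and even). -/
noncomputable def toeplitzMat (N : ℕ) (g : ℝ → ℝ) : Matrix (Fin N) (Fin N) ℝ :=
  Matrix.of fun i j => (fourierCoeffSym g ((i : ℤ) - (j : ℤ))).re

/-- Correction matrix `R_n^{p,α}`. -/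
noncomputable def Rmat (p n : ℕ) (α : ℝ) : Matrix (Fin (n + p - 2)) (Fin (n + p - 2)) ℝ :=
  ((n : ℝ) ^ (-α)) • Amat p n α - toeplitzMat (n + p - 2) (fSymbol p α)


noncomputable def phi : ℕ → ℝ → ℝ
  | 0, t => if 0 ≤ t ∧ t < 1 then 1 else 0
  | (k + 1), t => t / ((k : ℝ) + 1) * phi k t + ((k : ℝ) + 2 - t) / ((k : ℝ) + 1) * phi k (t - 1)

lemma phi_neg (k : ℕ) : ∀ t : ℝ, t < 0 → phi k t = 0 := by
  induction k with
  | zero => intro t ht; simp only [phi]; rw [if_neg]; rintro ⟨h, _⟩; linarith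
  | succ k ih => intro t ht; simp only [phi]; rw [ih t ht, ih (t - 1) (by linarith)]; ring

lemma phi_big (k : ℕ) : ∀ t : ℝ, (k : ℝ) + 1 ≤ t → phi k t = 0 := by
  induction k with
  | zero => intro t ht; simp only [phi]; rw [if_neg]; rintro ⟨_, h⟩; simp at ht; linarith
  | succ k ih =>
    intro t ht; push_cast at ht; simp only [phi]
    rw [ih t (by linarith), ih (t - 1) (by linarith)]; ring

lemma phi_bdd (k : ℕ) : ∃ C : ℝ, 0 ≤ C ∧ ∀ t, |phi k t| ≤ C := by
  induction k with
  | zero => refine ⟨1, by norm_num, fun t => ?_⟩; simp only [phi]; split_ifs <;> simp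
  | succ k ih =>
    obtain ⟨C, hC0, hC⟩ := ih
    refine ⟨4 * C, by linarith, fun t => ?_⟩
    have hk : (0:ℝ) ≤ k := Nat.cast_nonneg k
    by_cases h1 : t < 0
    · rw [phi_neg _ _ h1]; simp; linarith
    by_cases h2 : ((k + 1 : ℕ) : ℝ) + 1 ≤ t
    · rw [phi_big _ _ h2]; simp; linarith
    push Not at h1 h2
    push_cast at h2
    simp only [phi]
    have e1 : |t / ((k : ℝ) + 1)| ≤ 2 := by
      rw [abs_of_nonneg (by positivity), div_le_iff₀ (by positivity)]; linarith
    have e2 : |((k : ℝ) + 2 - t) / ((k : ℝ) + 1)| ≤ 2 := by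
      rw [abs_of_nonneg (div_nonneg (by linarith) (by positivity)), div_le_iff₀ (by positivity)]
      linarith
    calc _ ≤ |t / ((k : ℝ) + 1)| * |phi k t| + |((k : ℝ) + 2 - t) / ((k : ℝ) + 1)| * |phi k (t - 1)| := by
          rw [← abs_mul, ← abs_mul]; exact abs_add_le _ _
      _ ≤ 2 * C + 2 * C := by
          gcongr
          · exact hC _
          · exact hC _
      _ = _ := by ring

lemma phi_meas (k : ℕ) : Measurable (phi k) := by
  induction k with
  | zero =>
    have : phi 0 = fun t => if 0 ≤ t ∧ t < 1 then 1 else 0 := by funext t; simp only [phi]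
    rw [this]
    apply Measurable.ite _ measurable_const measurable_const
    exact measurableSet_Ico
  | succ k ih =>
    have : phi (k + 1) = fun t => t / ((k : ℝ) + 1) * phi k t + ((k : ℝ) + 2 - t) / ((k : ℝ) + 1) * phi k (t - 1) := by
      funext t; simp only [phi]
    rw [this]
    have := ih.comp (measurable_id.sub_const (1:ℝ))
    have h2 : Measurable fun t : ℝ => phi k (t - 1) := this
    fun_prop

lemma phi_one_eq (t : ℝ) : phi 1 t = max 0 (min t (2 - t)) := by
  simp only [phi]
  norm_num
  by_cases h0 : 0 ≤ t <;> by_cases h1 : t < 1 <;> by_cases h2 : t < 2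
  all_goals simp only [h0, h1, if_true, and_true, and_false, if_false]
  all_goals norm_num
  all_goals grind

lemma phi_cont (k : ℕ) : Continuous (phi (k + 1)) := by
  induction k with
  | zero =>
    have : phi (0 + 1) = fun t => max 0 (min t (2 - t)) := by funext t; exact phi_one_eq t
    rw [this]; fun_prop
  | succ k ih =>
    have : phi (k + 1 + 1) = fun t => t / (((k + 1 : ℕ) : ℝ) + 1) * phi (k + 1) t + (((k + 1 : ℕ) : ℝ) + 2 - t) / (((k + 1 : ℕ) : ℝ) + 1) * phi (k + 1) (t - 1) := by
      funext t; rw [phi]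
    rw [this]
    fun_prop

lemma phi_zero_right (t : ℝ) : HasDerivWithinAt (phi 0) 0 (Set.Ioi t) t := by
  have h : phi 0 =ᶠ[nhdsWithin t (Set.Ioi t)] fun _ => phi 0 t := by
    have : ∀ a : ℝ, ∀ᶠ s in nhdsWithin t (Set.Ioi t), (s < a ↔ t < a) := by
      intro a
      by_cases hta : t < a
      · filter_upwards [nhdsWithin_le_nhds (Iio_mem_nhds hta)] with s hs
        exact ⟨fun _ => hta, fun _ => hs⟩
      · filter_upwards [self_mem_nhdsWithin] with s hs
        have : t < s := hs
        constructor <;> intro h <;> linarith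
    filter_upwards [this 0, this 1] with s h0 h1
    simp only [phi, h1, ← not_lt, h0]
  exact (hasDerivWithinAt_const t (Set.Ioi t) (phi 0 t)).congr_of_eventuallyEq h rfl

lemma hdw_shift {f : ℝ → ℝ} {f' t : ℝ} (h : HasDerivWithinAt f f' (Set.Ioi (t - 1)) (t - 1)) :
    HasDerivWithinAt (fun s => f (s - 1)) f' (Set.Ioi t) t := by
  have h2 : HasDerivWithinAt (fun s : ℝ => s - 1) 1 (Set.Ioi t) t :=
    (hasDerivWithinAt_id t _).sub_const 1
  have := HasDerivWithinAt.comp (h := fun s : ℝ => s - 1) t h h2 (fun s hs => by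
    simp only [Set.mem_Ioi] at hs ⊢; linarith)
  rw [mul_one] at this
  exact this

lemma phi_right (k : ℕ) : ∀ t : ℝ,
    HasDerivWithinAt (phi (k + 1)) (phi k t - phi k (t - 1)) (Set.Ioi t) t := by
  have key : ∀ k : ℕ, ∀ t d1 d2 : ℝ, HasDerivWithinAt (phi k) d1 (Set.Ioi t) t →
      HasDerivWithinAt (phi k) d2 (Set.Ioi (t - 1)) (t - 1) →
      HasDerivWithinAt (phi (k + 1)) ((1 / ((k : ℝ) + 1) * phi k t + t / ((k : ℝ) + 1) * d1) +
        (-1 / ((k : ℝ) + 1) * phi k (t - 1) + ((k : ℝ) + 2 - t) / ((k : ℝ) + 1) * d2)) (Set.Ioi t) t := by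
    intro k t d1 d2 h1 h2
    have h2 := hdw_shift h2
    have a1 : HasDerivWithinAt (fun t : ℝ => t / ((k : ℝ) + 1)) (1 / ((k : ℝ) + 1)) (Set.Ioi t) t :=
      (hasDerivWithinAt_id t _).div_const _
    have a2 : HasDerivWithinAt (fun t : ℝ => ((k : ℝ) + 2 - t) / ((k : ℝ) + 1)) (-1 / ((k : ℝ) + 1)) (Set.Ioi t) t :=
      ((hasDerivWithinAt_id t _).const_sub _).div_const _
    have := (a1.mul h1).add (a2.mul h2)
    refine this.congr_of_eventuallyEq ?_ ?_
    · exact Filter.Eventually.of_forall fun s => by simp [phi]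
    · simp [phi]
  induction k with
  | zero =>
    intro t
    have := key 0 t 0 0 (phi_zero_right t) (phi_zero_right (t - 1))
    convert this using 1
    norm_num
    ring
  | succ k ih =>
    intro t
    have := key (k + 1) t _ _ (ih t) (ih (t - 1))
    convert this using 1
    have hk : (k : ℝ) + 1 ≠ 0 := by positivity
    have hk2 : (k : ℝ) + 1 + 1 ≠ 0 := by positivity
    have e1 : phi (k + 1) t = t / ((k : ℝ) + 1) * phi k t + ((k : ℝ) + 2 - t) / ((k : ℝ) + 1) * phi k (t - 1) := by rw [phi]
    have e2 : phi (k + 1) (t - 1) = (t - 1) / ((k : ℝ) + 1) * phi k (t - 1) + ((k : ℝ) + 2 - (t - 1)) / ((k : ℝ) + 1) * phi k (t - 1 - 1) := by rw [phi]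
    rw [e1, e2]
    push_cast
    field_simp
    ring

lemma phi_intble (k : ℕ) (a b : ℝ) : IntervalIntegrable (phi k) volume a b := by
  obtain ⟨C, hC0, hC⟩ := phi_bdd k
  refine (intervalIntegrable_const (c := C)).mono_fun (phi_meas k).aestronglyMeasurable ?_
  refine Filter.Eventually.of_forall fun t => ?_
  simp only [Real.norm_eq_abs]
  exact (hC t).trans (le_abs_self C)

lemma phi_shift_intble (k : ℕ) (a b c : ℝ) : IntervalIntegrable (fun t => phi k (t - c)) volume a b := by
  obtain ⟨C, hC0, hC⟩ := phi_bdd k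
  refine (intervalIntegrable_const (c := C)).mono_fun
    ((phi_meas k).comp (measurable_id.sub_const c)).aestronglyMeasurable ?_
  refine Filter.Eventually.of_forall fun t => ?_
  simp only [Real.norm_eq_abs]
  exact (hC _).trans (le_abs_self C)

lemma phi_ftc (k : ℕ) (a b : ℝ) :
    ∫ t in a..b, (phi k t - phi k (t - 1)) = phi (k + 1) b - phi (k + 1) a :=
  intervalIntegral.integral_eq_sub_of_hasDeriv_right (phi_cont k).continuousOn
    (fun t _ => phi_right k t) ((phi_intble k a b).sub (phi_shift_intble k a b 1))

lemma phi_hasDeriv (k : ℕ) (t : ℝ) (h1 : ContinuousAt (phi k) t) (h2 : ContinuousAt (phi k) (t - 1)) :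
    HasDerivAt (phi (k + 1)) (phi k t - phi k (t - 1)) t := by
  have hm : Measurable fun t => phi k t - phi k (t - 1) :=
    (phi_meas k).sub ((phi_meas k).comp (measurable_id.sub_const 1))
  have := intervalIntegral.integral_hasDerivAt_right (a := 0) (b := t)
    (f := fun t => phi k t - phi k (t - 1)) ((phi_intble k 0 t).sub (phi_shift_intble k 0 t 1))
    hm.stronglyMeasurable.stronglyMeasurableAtFilter
    (h1.sub (ContinuousAt.comp (f := fun t : ℝ => t - 1) h2 (by fun_prop)))
  have e : phi (k + 1) = fun b => (∫ t in (0:ℝ)..b, (phi k t - phi k (t - 1))) + phi (k + 1) 0 := by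
    funext b; rw [phi_ftc]; ring
  rw [e]
  exact this.add_const _

lemma phi_lip (k : ℕ) : ∃ C : ℝ, 0 ≤ C ∧ ∀ a b, |phi (k + 1) b - phi (k + 1) a| ≤ C * |b - a| := by
  obtain ⟨C, hC0, hC⟩ := phi_bdd k
  refine ⟨C + C, by positivity, fun a b => ?_⟩
  rw [← phi_ftc]
  rw [← Real.norm_eq_abs]
  refine intervalIntegral.norm_integral_le_of_norm_le_const (fun t _ => ?_)
  exact (abs_sub _ _).trans (add_le_add (hC _) (hC _))

lemma phi_cont_off (k : ℕ) (t : ℝ) (h0 : t ≠ 0) (h1 : t ≠ 1) : ContinuousAt (phi k) t := by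
  cases k with
  | succ k => exact (phi_cont k).continuousAt
  | zero =>
    have : phi 0 =ᶠ[nhds t] fun _ => phi 0 t := by
      have key : ∀ a : ℝ, t ≠ a → ∀ᶠ s in nhds t, (s < a ↔ t < a) := by
        intro a hta
        rcases lt_or_gt_of_ne hta with h | h
        · filter_upwards [Iio_mem_nhds h] with s hs
          exact ⟨fun _ => h, fun _ => hs⟩
        · filter_upwards [Ioi_mem_nhds h] with s hs
          have : a < s := hs
          constructor <;> intro h <;> linarith
      filter_upwards [key 0 h0, key 1 h1] with s h0 h1
      simp only [phi, h1, ← not_lt, h0]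
    exact (continuousAt_const (y := phi 0 t)).congr this.symm

lemma intg_aux {a : ℝ} (ha : -1 < a) {h : ℝ → ℝ} (hm : Measurable h) {C M : ℝ}
    (hC : ∀ v, |h v| ≤ C) (hM : ∀ v, M < v → h v = 0) :
    IntegrableOn (fun v => v ^ a * h v) (Set.Ioi 0) := by
  have h1 : IntegrableOn (fun v : ℝ => v ^ a) (Set.Ioc 0 (max M 0)) := by
    have := intervalIntegral.intervalIntegrable_rpow' ha (a := 0) (b := max M 0)
    rwa [intervalIntegrable_iff_integrableOn_Ioc_of_le (le_max_right _ _)] at this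
  have h2 : IntegrableOn (fun v => v ^ a * h v) (Set.Ioc 0 (max M 0)) := by
    refine Integrable.mul_bdd (c := C) h1 hm.aestronglyMeasurable ?_
    exact Filter.Eventually.of_forall fun v => hC v
  refine h2.of_forall_sdiff_eq_zero measurableSet_Ioi ?_
  rintro v ⟨hv, hv2⟩
  have : M < v := by
    by_contra hcon
    exact hv2 ⟨hv, le_max_of_le_left (not_lt.1 hcon)⟩
  rw [hM v this, mul_zero]

noncomputable def HH (α σ : ℝ) (k : ℕ) (t : ℝ) : ℝ :=
  ∫ v in Set.Ioi (0:ℝ), v ^ (1 - α) * phi k (t - σ * v)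

lemma phi_far (k : ℕ) {σ t v : ℝ} (hσ : σ = 1 ∨ σ = -1) (hv : |t| + (k + 1) < v) :
    phi k (t - σ * v) = 0 := by
  rcases hσ with rfl | rfl
  · apply phi_neg; have := le_abs_self t; have : (0:ℝ) ≤ k := Nat.cast_nonneg k; linarith
  · apply phi_big; have := neg_abs_le t; linarith

lemma HH_integrand (α : ℝ) (h2 : α < 2) {σ : ℝ} (hσ : σ = 1 ∨ σ = -1) (k : ℕ) (t : ℝ) :
    IntegrableOn (fun v => v ^ (1 - α) * phi k (t - σ * v)) (Set.Ioi 0) := by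
  obtain ⟨C, hC0, hC⟩ := phi_bdd k
  exact intg_aux (by linarith) ((phi_meas k).comp (by fun_prop)) (fun v => hC _)
    (fun v hv => phi_far k hσ hv)

lemma HH_deriv (α : ℝ) (h2 : α < 2) {σ : ℝ} (hσ : σ = 1 ∨ σ = -1) (k : ℕ) (t : ℝ) :
    HasDerivAt (HH α σ (k + 1)) (HH α σ k t - HH α σ k (t - 1)) t := by
  obtain ⟨C, hC0, hC⟩ := phi_lip k
  set M : ℝ := |t| + 1 + (k + 2) with hM
  set bd : ℝ → ℝ := fun v => v ^ (1 - α) * (Set.Iic M).indicator (fun _ => C) v with hbd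
  have hbd_int : IntegrableOn bd (Set.Ioi 0) := by
    refine intg_aux (C := C) (M := M) (by linarith) (measurable_const.indicator measurableSet_Iic) ?_ ?_
    · intro v; simp only [Set.indicator]; split_ifs
      · rw [abs_of_nonneg hC0]
      · simpa using hC0
    · intro v hv; rw [Set.indicator_of_notMem]; simpa using hv
  have key := hasDerivAt_integral_of_dominated_loc_of_lip (μ := volume.restrict (Set.Ioi (0:ℝ)))
    (F := fun x v => v ^ (1 - α) * phi (k + 1) (x - σ * v)) (x₀ := t)
    (F' := fun v => v ^ (1 - α) * phi k (t - σ * v) - v ^ (1 - α) * phi k (t - 1 - σ * v))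
    (bound := bd) (Metric.ball_mem_nhds t one_pos) ?_ ?_ ?_ ?_ hbd_int ?_
  · have := key.2
    rw [integral_sub (HH_integrand α h2 hσ k t) (HH_integrand α h2 hσ k (t - 1))] at this
    exact this
  · exact Filter.Eventually.of_forall fun x => (HH_integrand α h2 hσ (k + 1) x).aestronglyMeasurable
  · exact HH_integrand α h2 hσ (k + 1) t
  · exact ((HH_integrand α h2 hσ k t).sub (HH_integrand α h2 hσ k (t - 1))).aestronglyMeasurable
  · refine (ae_restrict_iff' measurableSet_Ioi).2 (Filter.Eventually.of_forall fun v hv => ?_)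
    have hv : (0:ℝ) < v := hv
    apply LipschitzOnWith.of_dist_le_mul
    intro x hx y hy
    simp only [Real.dist_eq, ← mul_sub, abs_mul, Real.coe_nnabs]
    have hp : 0 < v ^ (1 - α) := Real.rpow_pos_of_pos hv _
    by_cases hvM : v ≤ M
    · simp only [hbd]
      rw [Set.indicator_of_mem (show v ∈ Set.Iic M from hvM), abs_mul, abs_of_nonneg hC0, mul_assoc]
      refine mul_le_mul_of_nonneg_left ?_ (abs_nonneg _)
      refine (hC _ _).trans (le_of_eq ?_)
      congr 2; ring
    · push Not at hvM
      have hz : ∀ z ∈ Metric.ball t 1, phi (k + 1) (z - σ * v) = 0 := by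
        intro z hz
        apply phi_far _ hσ
        rw [Metric.mem_ball, Real.dist_eq] at hz
        have : |z| ≤ |z - t| + |t| := by
          have := abs_add_le (z - t) t; simpa using this
        push_cast
        linarith
      rw [hz x hx, hz y hy]
      simp only [sub_self, abs_zero, mul_zero]
      positivity
  · have hfin : ({σ * t, σ * (t - 1), σ * (t - 2)} : Set ℝ).Countable := Set.Finite.countable (by simp)
    have := hfin.ae_notMem (volume.restrict (Set.Ioi (0:ℝ)))
    filter_upwards [this] with v hv
    simp only [Set.mem_insert_iff, Set.mem_singleton_iff, not_or] at hv
    have hss : σ * σ = 1 := by rcases hσ with rfl | rfl <;> norm_num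
    have hne : ∀ a : ℝ, v ≠ σ * (t - a) → t - σ * v ≠ a := by
      intro a ha h
      apply ha
      have : σ * v = t - a := by linarith
      rw [← this, ← mul_assoc, hss, one_mul]
    have n0 := hne 0 (by simpa using hv.1)
    have n1 := hne 1 hv.2.1
    have n2 := hne 2 hv.2.2
    have hd := phi_hasDeriv k (t - σ * v) (phi_cont_off k _ n0 n1)
      (phi_cont_off k _ (by intro h; apply n1; linarith) (by intro h; apply n2; linarith))
    have hd2 := (HasDerivAt.comp_sub_const (f := phi (k + 1)) t (σ * v) hd).const_mul (v ^ (1 - α))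
    have ee : v ^ (1 - α) * phi k (t - σ * v) - v ^ (1 - α) * phi k (t - 1 - σ * v) =
        v ^ (1 - α) * (phi k (t - σ * v) - phi k (t - σ * v - 1)) := by
      rw [mul_sub]; congr 3; ring
    rw [ee]
    exact hd2

lemma HH_deriv2 (α : ℝ) (h2 : α < 2) {σ : ℝ} (hσ : σ = 1 ∨ σ = -1) (k : ℕ) (A c b z : ℝ) :
    deriv (deriv (fun z => A * HH α σ (k + 2) (b * z - c))) z =
      A * b ^ 2 * (HH α σ k (b * z - c) - 2 * HH α σ k (b * z - c - 1) + HH α σ k (b * z - c - 2)) := by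
  have hl : ∀ z d : ℝ, HasDerivAt (fun z : ℝ => b * z - d) b z := by
    intro z d
    simpa using ((hasDerivAt_id z).const_mul b).sub_const d
  have hc : ∀ k : ℕ, ∀ z d : ℝ, HasDerivAt (fun z => HH α σ (k + 1) (b * z - d))
      ((HH α σ k (b * z - d) - HH α σ k (b * z - d - 1)) * b) z := by
    intro k z d
    exact HasDerivAt.comp (h₂ := HH α σ (k + 1)) (h := fun z : ℝ => b * z - d) z (HH_deriv α h2 hσ k _) (hl z d)
  have e1 : deriv (fun z => A * HH α σ (k + 2) (b * z - c)) =
      fun z => A * ((HH α σ (k + 1) (b * z - c) - HH α σ (k + 1) (b * z - (c + 1))) * b) := by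
    funext z
    rw [((hc (k + 1) z c).const_mul A).deriv, sub_add_eq_sub_sub]
  have e2 : HasDerivAt (fun z => A * ((HH α σ (k + 1) (b * z - c) - HH α σ (k + 1) (b * z - (c + 1))) * b)) _ z :=
    (((hc k z c).sub (hc k z (c + 1))).mul_const b).const_mul A
  rw [e1, e2.deriv]
  rw [show b * z - (c + 1) = b * z - c - 1 by ring, show b * z - c - 1 - 1 = b * z - c - 2 by ring]
  ring

lemma HH_scale (α σ : ℝ) (k : ℕ) {b : ℝ} (hb : 0 < b) (c z : ℝ) :
    ∫ u in Set.Ioi (0:ℝ), u ^ (1 - α) * phi k (b * (z - σ * u) - c) =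
      b ^ (α - 2) * HH α σ k (b * z - c) := by
  have := integral_comp_mul_left_Ioi (fun v => v ^ (1 - α) * phi k (b * z - c - σ * v)) 0 hb
  rw [mul_zero] at this
  rw [HH]
  have e : ∫ u in Set.Ioi (0:ℝ), (b * u) ^ (1 - α) * phi k (b * z - c - σ * (b * u)) =
      b ^ (1 - α) * ∫ u in Set.Ioi (0:ℝ), u ^ (1 - α) * phi k (b * (z - σ * u) - c) := by
    rw [← integral_const_mul]
    refine setIntegral_congr_fun measurableSet_Ioi fun u hu => ?_
    rw [Real.mul_rpow hb.le (le_of_lt hu), mul_assoc]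
    congr 3; ring
  rw [e] at this
  have hb1 : b ^ (1 - α) ≠ 0 := (Real.rpow_pos_of_pos hb _).ne'
  have hb2 : b ^ (α - 2) = (b ^ (1 - α))⁻¹ * b⁻¹ := by
    rw [← Real.rpow_neg hb.le, ← Real.rpow_neg_one b, ← Real.rpow_add hb]; congr 1; ring
  rw [hb2, mul_assoc]
  rw [smul_eq_mul] at this
  rw [← this, ← mul_assoc, inv_mul_cancel₀ hb1, one_mul]

lemma left_eq (α : ℝ) (k : ℕ) {b c : ℝ} (hb : 0 < b) (hc : 0 ≤ c) {z : ℝ} (hz : 0 < z) :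
    ∫ y in (0:ℝ)..z, (z - y) ^ (1 - α) * phi k (b * y - c) =
      b ^ (α - 2) * HH α 1 k (b * z - c) := by
  rw [← HH_scale α 1 k hb]
  have := intervalIntegral.integral_comp_sub_left (a := 0) (b := z)
    (fun u : ℝ => u ^ (1 - α) * phi k (b * (z - 1 * u) - c)) z
  rw [sub_self, sub_zero] at this
  have e : ∀ y, b * (z - 1 * (z - y)) - c = b * y - c := by intro y; ring
  simp only [e] at this
  rw [this, intervalIntegral.integral_of_le hz.le]
  refine setIntegral_eq_of_subset_of_forall_sdiff_eq_zero measurableSet_Ioi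
    (fun u hu => hu.1) ?_ |>.symm
  rintro u ⟨hu, hu2⟩
  have : z < u := by
    by_contra hcon
    exact hu2 ⟨hu, not_lt.1 hcon⟩
  rw [phi_neg, mul_zero]
  have : b * (z - 1 * u) < 0 := mul_neg_of_pos_of_neg hb (by linarith)
  linarith

lemma right_eq (α : ℝ) (k : ℕ) {b c : ℝ} (hb : 0 < b) (hc : c + (k + 1) ≤ b) {z : ℝ} (hz : z < 1) :
    ∫ y in z..(1:ℝ), (y - z) ^ (1 - α) * phi k (b * y - c) =
      b ^ (α - 2) * HH α (-1) k (b * z - c) := by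
  rw [← HH_scale α (-1) k hb]
  have := intervalIntegral.integral_comp_sub_right (a := z) (b := 1)
    (fun u : ℝ => u ^ (1 - α) * phi k (b * (z - -1 * u) - c)) z
  rw [sub_self] at this
  have e : ∀ y, b * (z - -1 * (y - z)) - c = b * y - c := by intro y; ring
  simp only [e] at this
  rw [this, intervalIntegral.integral_of_le (by linarith)]
  refine setIntegral_eq_of_subset_of_forall_sdiff_eq_zero measurableSet_Ioi
    (fun u hu => hu.1) ?_ |>.symm
  rintro u ⟨hu, hu2⟩
  have : 1 - z < u := by
    by_contra hcon
    exact hu2 ⟨hu, not_lt.1 hcon⟩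
  rw [phi_big, mul_zero]
  have : b * 1 ≤ b * (z - -1 * u) := mul_le_mul_of_nonneg_left (by linarith) hb.le
  linarith

lemma knot_mid (p n i : ℕ) (hn : 0 < n) (h1 : p + 1 ≤ i) (h2 : i ≤ n + p + 1) :
    knot p n i = ((i : ℝ) - ((p : ℝ) + 1)) / n := by
  have hn' : (n : ℝ) ≠ 0 := by positivity
  unfold knot
  split_ifs with a b
  · have : i = p + 1 := by omega
    subst this; push_cast; simp
  · have : i = n + p + 1 := by omega
    subst this; push_cast; field_simp; ring
  · rfl

lemma bspline_mid (p n : ℕ) (hn : 0 < n) (k : ℕ) : ∀ i : ℕ, p + 1 ≤ i → i + k + 1 ≤ n + p + 1 →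
    ∀ x : ℝ, bspline p n k i x = phi k (n * x - ((i : ℝ) - ((p : ℝ) + 1))) := by
  have hn' : (0 : ℝ) < n := by positivity
  induction k with
  | zero =>
    intro i h1 h2 x
    simp only [bspline, phi]
    rw [knot_mid p n i hn h1 (by omega), knot_mid p n (i + 1) hn (by omega) (by omega)]
    congr 1
    rw [div_le_iff₀ hn', lt_div_iff₀ hn']
    push_cast
    apply propext
    constructor
    · rintro ⟨a, b⟩; constructor <;> linarith
    · rintro ⟨a, b⟩; constructor <;> linarith
  | succ k ih =>
    intro i h1 h2 x
    simp only [bspline, phi]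
    rw [ih i h1 (by omega), ih (i + 1) (by omega) (by omega)]
    rw [knot_mid p n i hn h1 (by omega), knot_mid p n (i + 1) hn (by omega) (by omega),
      knot_mid p n (i + k + 1) hn (by omega) (by omega), knot_mid p n (i + k + 2) hn (by omega) (by omega)]
    have hk : (0:ℝ) < (k : ℝ) + 1 := by positivity
    have d1 : (((i + k + 1 : ℕ) : ℝ) - ((p : ℝ) + 1)) / n - ((i : ℝ) - ((p : ℝ) + 1)) / n = (k + 1) / n := by
      push_cast; field_simp; ring
    have d2 : (((i + k + 2 : ℕ) : ℝ) - ((p : ℝ) + 1)) / n - (((i + 1 : ℕ) : ℝ) - ((p : ℝ) + 1)) / n = (k + 1) / n := by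
      push_cast; field_simp; ring
    have hpos : ((k : ℝ) + 1) / n ≠ 0 := by positivity
    rw [if_neg (by rw [← sub_eq_zero, d1]; exact hpos), if_neg (by rw [← sub_eq_zero, d2]; exact hpos), d1, d2]
    have e : (n : ℝ) * x - (((i + 1 : ℕ) : ℝ) - ((p : ℝ) + 1)) = n * x - ((i : ℝ) - ((p : ℝ) + 1)) - 1 := by
      push_cast; ring
    rw [e]
    congr 2
    · field_simp
    · push_cast; field_simp; ring

lemma greville_mid (p n m : ℕ) (hp : 0 < p) (hn : 0 < n) (h1 : p + 1 ≤ m) (h2 : m ≤ n) :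
    greville p n m = ((m : ℝ) - (p + 1) + (p + 1) / 2) / n := by
  have hn' : (n : ℝ) ≠ 0 := by positivity
  have hp' : (p : ℝ) ≠ 0 := by positivity
  unfold greville
  have : ∀ j ∈ Finset.range p, knot p n (m + 1 + j) = ((m : ℝ) - p) / n + (j : ℝ) * (1 / n) := by
    intro j hj
    rw [Finset.mem_range] at hj
    rw [knot_mid p n _ hn (by omega) (by omega)]
    push_cast; field_simp; ring
  rw [Finset.sum_congr rfl this, Finset.sum_add_distrib, ← Finset.sum_mul]
  have hs : (∑ j ∈ Finset.range p, (j : ℝ)) = p * (p - 1) / 2 := by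
    have := Finset.sum_range_id_mul_two p
    have h3 : ((∑ i ∈ Finset.range p, i : ℕ) : ℝ) * 2 = p * ((p - 1 : ℕ) : ℝ) := by exact_mod_cast this
    rw [Nat.cast_sub (by omega)] at h3
    push_cast at h3
    linarith
  rw [hs]
  simp only [Finset.sum_const, Finset.card_range, nsmul_eq_mul]
  field_simp
  ring

/-- the good entries -/
lemma entry_eq (p n i j : ℕ) (hp : 2 ≤ p) (α : ℝ) (h2 : α < 2) (hi : p + 1 ≤ i)
    (hi2 : i ≤ n) (hj : p + 1 ≤ j) (hj2 : j ≤ n) (t : ℝ)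
    (ht : t = ((i : ℝ) - j) + (p + 1) / 2) :
    RLD0x α (bspline p n p j) (greville p n i) = 1 / Real.Gamma (2 - α) * ((n : ℝ) ^ α *
      (HH α 1 (p - 2) t - 2 * HH α 1 (p - 2) (t - 1) + HH α 1 (p - 2) (t - 2))) ∧
    RLDx1 α (bspline p n p j) (greville p n i) = 1 / Real.Gamma (2 - α) * ((n : ℝ) ^ α *
      (HH α (-1) (p - 2) t - 2 * HH α (-1) (p - 2) (t - 1) + HH α (-1) (p - 2) (t - 2))) := by
  have hn : 0 < n := by omega
  have hn' : (0 : ℝ) < n := by positivity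
  have hiR : (p : ℝ) + 1 ≤ i := by exact_mod_cast hi
  have hiR2 : (i : ℝ) ≤ n := by exact_mod_cast hi2
  have hjR : (p : ℝ) + 1 ≤ j := by exact_mod_cast hj
  have hjR2 : (j : ℝ) ≤ n := by exact_mod_cast hj2
  have hpR : (0 : ℝ) ≤ p := Nat.cast_nonneg p
  have hb : bspline p n p j = fun x => phi p (n * x - ((j : ℝ) - ((p : ℝ) + 1))) := by
    funext x; exact bspline_mid p n hn p j hj (by omega) x
  have hg := greville_mid p n i (by omega) hn hi hi2
  have hg0 : 0 < greville p n i := by rw [hg]; apply div_pos _ hn'; linarith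
  have hg1 : greville p n i < 1 := by rw [hg, div_lt_one hn']; linarith
  have htg : (n : ℝ) * greville p n i - ((j : ℝ) - ((p : ℝ) + 1)) = t := by
    rw [hg, ht]; field_simp; ring
  have hpow : (n : ℝ) ^ (α - 2) * (n : ℝ) ^ 2 = (n : ℝ) ^ α := by
    rw [← Real.rpow_natCast, ← Real.rpow_add hn']; congr 1; push_cast; ring
  obtain ⟨q, rfl⟩ : ∃ q, p = q + 2 := ⟨p - 2, by omega⟩
  rw [hb]
  constructor
  · unfold RLD0x
    congr 1
    have : (fun z => ∫ y in (0:ℝ)..z, (z - y) ^ (1 - α) * phi (q + 2) (n * y - ((j : ℝ) - (((q + 2 : ℕ) : ℝ) + 1))))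
        =ᶠ[nhds (greville (q + 2) n i)] fun z => (n : ℝ) ^ (α - 2) * HH α 1 (q + 2) (n * z - ((j : ℝ) - (((q + 2 : ℕ) : ℝ) + 1))) := by
      filter_upwards [Ioi_mem_nhds hg0] with z hz
      exact left_eq α (q + 2) hn' (by linarith) hz
    rw [this.deriv.deriv_eq, HH_deriv2 α h2 (Or.inl rfl), htg, hpow]
    rfl
  · unfold RLDx1
    congr 1
    have : (fun z => ∫ y in z..(1:ℝ), (y - z) ^ (1 - α) * phi (q + 2) (n * y - ((j : ℝ) - (((q + 2 : ℕ) : ℝ) + 1))))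
        =ᶠ[nhds (greville (q + 2) n i)] fun z => (n : ℝ) ^ (α - 2) * HH α (-1) (q + 2) (n * z - ((j : ℝ) - (((q + 2 : ℕ) : ℝ) + 1))) := by
      filter_upwards [Iio_mem_nhds hg1] with z hz
      exact right_eq α (q + 2) hn' (by linarith) hz
    rw [this.deriv.deriv_eq, HH_deriv2 α h2 (Or.inr rfl), htg, hpow]
    rfl

lemma gam1 {s v : ℝ} (hs : 0 < s) (hv : 0 < v) :
    ∫ t in Set.Ioi (0:ℝ), t ^ (s / 2 - 1) * Real.exp (-(v ^ 2 * t)) = v ^ (-s) * Real.Gamma (s / 2) := by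
  rw [Real.integral_rpow_mul_exp_neg_mul_Ioi (by linarith) (by positivity)]
  congr 1
  rw [one_div, Real.inv_rpow (by positivity), ← Real.rpow_natCast, ← Real.rpow_mul hv.le,
    ← Real.rpow_neg hv.le]
  congr 1; push_cast; ring

lemma gam1_int {s v : ℝ} (hs : 0 < s) (hv : 0 < v) :
    IntegrableOn (fun t => t ^ (s / 2 - 1) * Real.exp (-(v ^ 2 * t))) (Set.Ioi (0:ℝ)) := by
  apply Integrable.of_integral_ne_zero
  rw [gam1 hs hv]
  have := Real.Gamma_pos_of_pos (show 0 < s / 2 by linarith)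
  positivity

lemma gam2 {s w : ℝ} (hs : s < 1) (hw : w ≠ 0) :
    ∫ t in Set.Ioi (0:ℝ), t ^ (s / 2 - 3 / 2) * Real.exp (-(w ^ 2 / (4 * t))) =
      |w| ^ (s - 1) * (2 ^ (1 - s) * Real.Gamma ((1 - s) / 2)) := by
  have h1 := integral_comp_rpow_Ioi (fun t : ℝ => t ^ ((1 - s) / 2 - 1) * Real.exp (-(w ^ 2 / 4 * t)))
    (p := -1) (by norm_num)
  have hw' : 0 < |w| := abs_pos.2 hw
  have hw2 : 0 < w ^ 2 := by positivity
  rw [Real.integral_rpow_mul_exp_neg_mul_Ioi (by linarith) (by positivity)] at h1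
  have h2 : ∫ t in Set.Ioi (0:ℝ), t ^ (s / 2 - 3 / 2) * Real.exp (-(w ^ 2 / (4 * t))) =
      (1 / (w ^ 2 / 4)) ^ ((1 - s) / 2) * Real.Gamma ((1 - s) / 2) := by
    rw [← h1]
    refine setIntegral_congr_fun measurableSet_Ioi fun t ht => ?_
    have ht : (0:ℝ) < t := ht
    simp only [smul_eq_mul, abs_neg, abs_one, one_mul]
    rw [← Real.rpow_mul ht.le, ← mul_assoc, ← Real.rpow_add ht]
    congr 2
    · ring
    · rw [Real.rpow_neg_one]; field_simp
  rw [h2]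
  rw [show (1 / (w ^ 2 / 4) : ℝ) = (2 / |w|) ^ (2:ℕ) by rw [div_pow, sq_abs]; field_simp; norm_num]
  rw [← Real.rpow_natCast, ← Real.rpow_mul (by positivity)]
  rw [show ((2:ℕ):ℝ) * ((1 - s) / 2) = 1 - s by push_cast; ring]
  rw [Real.div_rpow (by norm_num) hw'.le, show s - 1 = -(1 - s) by ring, Real.rpow_neg hw'.le]
  ring

lemma gam2_int {s w : ℝ} (hs : s < 1) (hw : w ≠ 0) :
    IntegrableOn (fun t => t ^ (s / 2 - 3 / 2) * Real.exp (-(w ^ 2 / (4 * t)))) (Set.Ioi (0:ℝ)) := by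
  apply Integrable.of_integral_ne_zero
  rw [gam2 hs hw]
  have := Real.Gamma_pos_of_pos (show 0 < (1 - s) / 2 by linarith)
  have hw' : 0 < |w| := abs_pos.2 hw
  positivity

lemma gauss_int {t : ℝ} (ht : 0 < t) : Integrable (fun w : ℝ => Real.exp (-(w ^ 2 / (4 * t)))) := by
  have := integrable_exp_neg_mul_sq (b := 1 / (4 * t)) (by positivity)
  refine this.congr (Filter.Eventually.of_forall fun w => ?_)
  simp only
  congr 1; ring

lemma gauss_cos {t : ℝ} (ht : 0 < t) (v : ℝ) :
    ∫ w : ℝ, Real.cos (w * v) * Real.exp (-(w ^ 2 / (4 * t))) =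
      2 * √Real.pi * √t * Real.exp (-(v ^ 2 * t)) := by
  have hpi := Real.pi_pos
  have h := fourierIntegral_gaussian (b := ((1 / (4 * t) : ℝ) : ℂ)) (by rw [Complex.ofReal_re]; positivity) (v : ℂ)
  have h' := congrArg Complex.re h
  have e1 : ((Real.pi : ℂ) / ((1 / (4 * t) : ℝ) : ℂ)) ^ (1 / 2 : ℂ) * Complex.exp (-(v : ℂ) ^ 2 / (4 * ((1 / (4 * t) : ℝ) : ℂ)))
      = ((2 * √Real.pi * √t * Real.exp (-(v ^ 2 * t)) : ℝ) : ℂ) := by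
    rw [← Complex.ofReal_div]
    rw [show (1 / 2 : ℂ) = ((1 / 2 : ℝ) : ℂ) by push_cast; rfl]
    rw [← Complex.ofReal_cpow (by positivity), ← Real.sqrt_eq_rpow]
    rw [show (-(v : ℂ) ^ 2 / (4 * ((1 / (4 * t) : ℝ) : ℂ))) = ((-(v ^ 2 * t) : ℝ) : ℂ) by
      have : (t : ℂ) ≠ 0 := by exact_mod_cast ht.ne'
      push_cast; field_simp]
    rw [← Complex.ofReal_exp, ← Complex.ofReal_mul]
    congr 2
    rw [show Real.pi / (1 / (4 * t)) = 2 ^ 2 * (Real.pi * t) by field_simp; norm_num]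
    rw [Real.sqrt_mul (by norm_num), Real.sqrt_sq (by norm_num), Real.sqrt_mul hpi.le]; ring
  rw [e1, Complex.ofReal_re] at h'
  rw [← h']
  have hint : Integrable (fun x : ℝ => Complex.exp (Complex.I * v * x) * Complex.exp (-((1 / (4 * t) : ℝ) : ℂ) * x ^ 2)) := by
    have hg := (gauss_int ht).ofReal (𝕜 := ℂ)
    refine (hg.bdd_mul (f := fun x : ℝ => Complex.exp (Complex.I * v * x)) (c := 1)
      (Continuous.aestronglyMeasurable (by fun_prop)) (Filter.Eventually.of_forall fun x => ?_)).congr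
      (Filter.Eventually.of_forall fun x => ?_)
    · rw [show Complex.I * v * x = ((v * x : ℝ) : ℂ) * Complex.I by push_cast; ring, Complex.norm_exp_ofReal_mul_I]
    · simp only
      congr 1
      rw [show -((1 / (4 * t) : ℝ) : ℂ) * (x : ℂ) ^ 2 = ((-(x ^ 2 / (4 * t)) : ℝ) : ℂ) by push_cast; ring]
      exact Complex.ofReal_exp _
  have := integral_re hint
  simp only [RCLike.re_to_complex] at this
  rw [← this]
  congr 1
  funext x
  rw [show Complex.I * v * x = ((x * v : ℝ) : ℂ) * Complex.I by push_cast; ring]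
  rw [show -((1 / (4 * t) : ℝ) : ℂ) * (x : ℂ) ^ 2 = ((-(x ^ 2 / (4 * t)) : ℝ) : ℂ) by push_cast; ring]
  rw [← Complex.ofReal_exp, Complex.re_mul_ofReal, Complex.exp_ofReal_mul_I_re]

lemma riesz {s : ℝ} (hs0 : 0 < s) (hs1 : s < 1) {G : ℝ → ℝ} (hm : Measurable G) {C M : ℝ}
    (hC : ∀ v, |G v| ≤ C) (hM : ∀ v, M < v → G v = 0) {K : ℝ → ℝ} (hK : Measurable K)
    (hKeq : ∀ w, w ≠ 0 → ∫ v in Set.Ioi (0:ℝ), Real.cos (w * v) * G v = K w)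
    (hint : Integrable (fun w => |w| ^ (s - 1) * K w)) :
    Real.Gamma (s / 2) * ∫ v in Set.Ioi (0:ℝ), v ^ (-s) * G v =
      1 / (2 * √Real.pi) * (2 ^ (1 - s) * Real.Gamma ((1 - s) / 2)) * ∫ w, |w| ^ (s - 1) * K w := by
  have hpi := Real.pi_pos
  have hae : ∀ᵐ w : ℝ, w ≠ 0 := Measure.ae_ne volume 0
  have hGint : IntegrableOn G (Set.Ioi 0) := by
    have := intg_aux (a := 0) (by norm_num) hm hC hM
    simpa using this
  have hGs : IntegrableOn (fun v => v ^ (-s) * G v) (Set.Ioi 0) := intg_aux (by linarith) hm hC hM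
  -- swap 1
  have s1 : Real.Gamma (s / 2) * ∫ v in Set.Ioi (0:ℝ), v ^ (-s) * G v =
      ∫ t in Set.Ioi (0:ℝ), ∫ v in Set.Ioi (0:ℝ), t ^ (s / 2 - 1) * Real.exp (-(v ^ 2 * t)) * G v := by
    rw [← integral_integral_swap (f := fun v t : ℝ => t ^ (s / 2 - 1) * Real.exp (-(v ^ 2 * t)) * G v)]
    · rw [← integral_const_mul]
      refine setIntegral_congr_fun measurableSet_Ioi fun v hv => ?_
      rw [integral_mul_const, gam1 hs0 hv]; ring
    · rw [integrable_prod_iff]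
      · constructor
        · refine (ae_restrict_iff' measurableSet_Ioi).2 (Filter.Eventually.of_forall fun v hv => ?_)
          exact (gam1_int hs0 hv).mul_const (G v)
        · refine (hGs.norm.const_mul (Real.Gamma (s / 2))).congr ?_
          refine (ae_restrict_iff' measurableSet_Ioi).2 (Filter.Eventually.of_forall fun v hv => ?_)
          have hv' : (0:ℝ) < v := hv
          have : ∀ t ∈ Set.Ioi (0:ℝ), ‖t ^ (s / 2 - 1) * Real.exp (-(v ^ 2 * t)) * G v‖ =
              t ^ (s / 2 - 1) * Real.exp (-(v ^ 2 * t)) * |G v| := by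
            intro t ht
            have ht : (0:ℝ) < t := ht
            rw [norm_mul, Real.norm_of_nonneg (by positivity), Real.norm_eq_abs]
          simp only [Function.uncurry]
          rw [setIntegral_congr_fun measurableSet_Ioi this, integral_mul_const, gam1 hs0 hv]
          rw [norm_mul, Real.norm_of_nonneg (by positivity), Real.norm_eq_abs]; ring
      · apply Measurable.aestronglyMeasurable
        simp only [Function.uncurry_def]
        fun_prop
  -- swap 2
  have s2 : ∀ t ∈ Set.Ioi (0:ℝ), ∫ v in Set.Ioi (0:ℝ), t ^ (s / 2 - 1) * Real.exp (-(v ^ 2 * t)) * G v =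
      1 / (2 * √Real.pi) * ∫ w, t ^ (s / 2 - 3 / 2) * Real.exp (-(w ^ 2 / (4 * t))) * K w := by
    intro t ht
    have ht : (0:ℝ) < t := ht
    have hsw := integral_integral_swap (μ := volume.restrict (Set.Ioi (0:ℝ))) (ν := (volume : Measure ℝ))
      (f := fun v w : ℝ => Real.cos (w * v) * (G v * Real.exp (-(w ^ 2 / (4 * t))))) (by
        have := hGint.mul_prod (gauss_int ht)
        refine this.bdd_mul (f := fun z : ℝ × ℝ => Real.cos (z.2 * z.1)) (c := 1) (Continuous.aestronglyMeasurable (by fun_prop)) ?_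
        exact Filter.Eventually.of_forall fun z => Real.abs_cos_le_one _)
    have a1 : ∀ v : ℝ, ∫ w : ℝ, Real.cos (w * v) * (G v * Real.exp (-(w ^ 2 / (4 * t)))) =
        2 * √Real.pi * √t * (Real.exp (-(v ^ 2 * t)) * G v) := by
      intro v
      rw [← mul_assoc, ← gauss_cos ht v, ← integral_mul_const]
      congr 1; funext w; ring
    have a2 : ∀ w : ℝ, w ≠ 0 → ∫ v in Set.Ioi (0:ℝ), Real.cos (w * v) * (G v * Real.exp (-(w ^ 2 / (4 * t)))) =
        Real.exp (-(w ^ 2 / (4 * t))) * K w := by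
      intro w hw
      rw [← hKeq w hw, ← integral_const_mul]
      congr 1; funext v; ring
    simp only [a1] at hsw
    rw [integral_const_mul, integral_congr_ae (hae.mono a2)] at hsw
    simp only [mul_assoc]
    rw [integral_const_mul, integral_const_mul]
    rw [← hsw]
    have e : t ^ (s / 2 - 1) = t ^ (s / 2 - 3 / 2) * √t := by
      rw [Real.sqrt_eq_rpow, ← Real.rpow_add ht]; congr 1; ring
    rw [e]
    have : √Real.pi ≠ 0 := by positivity
    generalize ∫ a in Set.Ioi (0:ℝ), Real.exp (-(a ^ 2 * t)) * G a = J
    field_simp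
  -- swap 3
  have s3 : ∫ t in Set.Ioi (0:ℝ), ∫ w, t ^ (s / 2 - 3 / 2) * Real.exp (-(w ^ 2 / (4 * t))) * K w =
      (2 ^ (1 - s) * Real.Gamma ((1 - s) / 2)) * ∫ w, |w| ^ (s - 1) * K w := by
    rw [← integral_integral_swap (f := fun w t : ℝ => t ^ (s / 2 - 3 / 2) * Real.exp (-(w ^ 2 / (4 * t))) * K w)]
    · rw [← integral_const_mul]
      refine integral_congr_ae (hae.mono fun w hw => ?_)
      simp only
      rw [integral_mul_const, gam2 hs1 hw]; ring
    · rw [integrable_prod_iff]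
      · constructor
        · exact hae.mono fun w hw => (gam2_int hs1 hw).mul_const (K w)
        · refine (hint.norm.const_mul (2 ^ (1 - s) * Real.Gamma ((1 - s) / 2))).congr ?_
          refine hae.mono fun w hw => ?_
          have : ∀ t ∈ Set.Ioi (0:ℝ), ‖t ^ (s / 2 - 3 / 2) * Real.exp (-(w ^ 2 / (4 * t))) * K w‖ =
              t ^ (s / 2 - 3 / 2) * Real.exp (-(w ^ 2 / (4 * t))) * |K w| := by
            intro t ht
            have ht : (0:ℝ) < t := ht
            rw [norm_mul, Real.norm_of_nonneg (by positivity), Real.norm_eq_abs]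
          simp only [Function.uncurry]
          rw [setIntegral_congr_fun measurableSet_Ioi this, integral_mul_const, gam2 hs1 hw]
          rw [norm_mul, Real.norm_of_nonneg (by positivity), Real.norm_eq_abs]; ring
      · apply Measurable.aestronglyMeasurable
        simp only [Function.uncurry_def]
        fun_prop
  rw [s1, setIntegral_congr_fun measurableSet_Ioi s2, integral_const_mul, s3]
  ring

lemma const_eq {α : ℝ} (h1 : 1 < α) (h2 : α < 2) :
    1 / (2 * Real.cos (Real.pi * α / 2)) * (1 / Real.Gamma (2 - α)) *
      ((1 / (2 * √Real.pi) * (2 ^ (2 - α) * Real.Gamma ((2 - α) / 2))) / Real.Gamma ((α - 1) / 2)) =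
      -(1 / (2 * Real.pi)) := by
  have hpi := Real.pi_pos
  have hsq : √Real.pi * √Real.pi = Real.pi := Real.mul_self_sqrt hpi.le
  have d := Real.Gamma_mul_Gamma_add_half_of_pos (s := (2 - α) / 2) (by linarith)
  have r := Real.Gamma_mul_Gamma_one_sub ((α - 1) / 2)
  rw [show (2 - α) / 2 + 1 / 2 = (3 - α) / 2 by ring, show 2 * ((2 - α) / 2) = 2 - α by ring,
    show 1 - (2 - α) = α - 1 by ring] at d
  rw [show 1 - (α - 1) / 2 = (3 - α) / 2 by ring,
    show Real.pi * ((α - 1) / 2) = Real.pi * α / 2 - Real.pi / 2 by ring, Real.sin_sub_pi_div_two] at r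
  have hcos : Real.cos (Real.pi * α / 2) < 0 := by
    apply Real.cos_neg_of_pi_div_two_lt_of_lt <;> nlinarith
  have g1 := Real.Gamma_pos_of_pos (show 0 < (2 - α) / 2 by linarith)
  have g2 := Real.Gamma_pos_of_pos (show 0 < (3 - α) / 2 by linarith)
  have g3 := Real.Gamma_pos_of_pos (show 0 < 2 - α by linarith)
  have g4 := Real.Gamma_pos_of_pos (show 0 < (α - 1) / 2 by linarith)
  have hs : 0 < √Real.pi := by positivity
  have e2 : (2:ℝ) ^ (2 - α) * 2 ^ (α - 1) = 2 := by
    rw [← Real.rpow_add (by norm_num)]; norm_num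
  have hcne := hcos.ne
  generalize Real.cos (Real.pi * α / 2) = c at *
  generalize Real.Gamma ((2 - α) / 2) = A at *
  generalize Real.Gamma ((3 - α) / 2) = B at *
  generalize Real.Gamma (2 - α) = D at *
  generalize Real.Gamma ((α - 1) / 2) = E at *
  generalize (2:ℝ) ^ (2 - α) = u at *
  generalize (2:ℝ) ^ (α - 1) = w at *
  have hA : A = D * w * √Real.pi / B := by field_simp; linarith
  have hE : E = -(Real.pi / c) / B := by
    have : E * B = -(Real.pi / c) := by rw [r, div_neg]
    field_simp at this ⊢
    linarith
  rw [hA, hE]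
  generalize √Real.pi = q at *
  field_simp
  linear_combination (-1) * e2

lemma phi_integrable (k : ℕ) : Integrable (phi k) := by
  have h : IntegrableOn (phi k) (Set.Ioc (-1) ((k:ℝ) + 1)) := by
    have hk : (0:ℝ) ≤ k := Nat.cast_nonneg k
    have := phi_intble k (-1) ((k:ℝ) + 1)
    rwa [intervalIntegrable_iff_integrableOn_Ioc_of_le (by linarith)] at this
  rw [← integrableOn_univ]
  refine h.of_forall_sdiff_eq_zero MeasurableSet.univ ?_
  rintro v ⟨_, hv2⟩
  by_cases h0 : v < 0
  · exact phi_neg k v h0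
  · apply phi_big; push Not at h0
    by_contra hcon
    exact hv2 ⟨by linarith, by linarith⟩

lemma norm_e (w y : ℝ) : ‖Complex.exp (-(Complex.I * w * y))‖ = 1 := by
  rw [show -(Complex.I * w * y) = ((-(w * y) : ℝ) : ℂ) * Complex.I by push_cast; ring,
    Complex.norm_exp_ofReal_mul_I]

lemma mul_e_int {f : ℝ → ℝ} (hf : Integrable f) (w : ℝ) :
    Integrable (fun y : ℝ => (f y : ℂ) * Complex.exp (-(Complex.I * w * y))) := by
  refine (hf.ofReal (𝕜 := ℂ)).mul_bdd (c := 1) (Continuous.aestronglyMeasurable (by fun_prop)) ?_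
  exact Filter.Eventually.of_forall fun y => (norm_e w y).le

noncomputable def EE (k : ℕ) (w : ℝ) : ℂ := ∫ y : ℝ, (phi k y : ℂ) * Complex.exp (-(Complex.I * w * y))

lemma EE_shift (k : ℕ) (w c : ℝ) :
    ∫ y : ℝ, (phi k (y - c) : ℂ) * Complex.exp (-(Complex.I * w * y)) =
      Complex.exp (-(Complex.I * w * c)) * EE k w := by
  rw [EE, ← integral_const_mul,
    ← integral_sub_right_eq_self (μ := volume) (fun y : ℝ => Complex.exp (-(Complex.I * w * c)) * ((phi k y : ℂ) * Complex.exp (-(Complex.I * w * y)))) c]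
  congr 1; funext y
  rw [mul_left_comm, ← Complex.exp_add]
  congr 2; push_cast; ring

lemma EE_zero (w : ℝ) (hw : w ≠ 0) :
    Complex.I * w * EE 0 w = 1 - Complex.exp (-(Complex.I * w)) := by
  have hc : -(Complex.I * w) ≠ 0 := by simp [hw]
  have h := integral_exp_mul_complex (a := 0) (b := 1) hc
  have : EE 0 w = ∫ x in (0:ℝ)..1, Complex.exp (-(Complex.I * w) * x) := by
    rw [EE, intervalIntegral.integral_of_le zero_le_one, integral_Ioc_eq_integral_Ioo,
      ← integral_Ico_eq_integral_Ioo, ← integral_indicator measurableSet_Ico]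
    congr 1; funext y
    by_cases hy : 0 ≤ y ∧ y < 1
    · rw [Set.indicator_of_mem (show y ∈ Set.Ico (0:ℝ) 1 from hy)]
      simp only [phi, hy, and_self, if_true]
      simp
    · rw [Set.indicator_of_notMem (show y ∉ Set.Ico (0:ℝ) 1 from hy)]
      simp only [phi, hy, if_false]
      simp
  rw [this, h]
  simp only [Complex.ofReal_one, mul_one, Complex.ofReal_zero, mul_zero, Complex.exp_zero]
  have hwc : (w : ℂ) ≠ 0 := by exact_mod_cast hw
  generalize Complex.exp (-(Complex.I * w)) = a
  have hI := Complex.I_ne_zero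
  field_simp
  ring

lemma EE_succ (k : ℕ) (w : ℝ) :
    Complex.I * w * EE (k + 1) w = (1 - Complex.exp (-(Complex.I * w))) * EE k w := by
  have hk : (0:ℝ) ≤ k := Nat.cast_nonneg k
  set e : ℝ → ℂ := fun y => Complex.exp (-(Complex.I * w * y)) with he
  have hed : ∀ y : ℝ, HasDerivAt e (e y * -(Complex.I * w)) y := by
    intro y
    have h1 : HasDerivAt (fun y : ℝ => -(Complex.I * w * y)) (-(Complex.I * w)) y := by
      have h2 : HasDerivAt (fun y : ℝ => (y : ℂ)) 1 y := Complex.ofRealCLM.hasDerivAt (x := y)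
      have := (h2.const_mul (Complex.I * w)).neg
      rw [mul_one] at this
      exact this
    exact h1.cexp
  set D : ℝ → ℂ := fun y => ((phi k y - phi k (y - 1) : ℝ) : ℂ) * e y + (phi (k + 1) y : ℂ) * (e y * -(Complex.I * w)) with hD
  have hsh : Integrable (fun y => phi k (y - 1)) := (phi_integrable k).comp_sub_right 1
  have i1 : Integrable (fun y => (phi k y : ℂ) * e y) := mul_e_int (phi_integrable k) w
  have i2 : Integrable (fun y => (phi k (y - 1) : ℂ) * e y) := mul_e_int hsh w
  have i3 : Integrable (fun y => (phi (k + 1) y : ℂ) * e y) := mul_e_int (phi_integrable (k + 1)) w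
  have hDe : D = fun y => ((phi k y : ℂ) * e y - (phi k (y - 1) : ℂ) * e y) - Complex.I * w * ((phi (k + 1) y : ℂ) * e y) := by
    funext y; simp only [hD]; push_cast; ring
  have i12 : Integrable (fun y => (phi k y : ℂ) * e y - (phi k (y - 1) : ℂ) * e y) := i1.sub i2
  have hDint : Integrable D := by rw [hDe]; exact (i1.sub i2).sub (i3.const_mul _)
  have h0 : ∫ y in (-1:ℝ)..((k:ℝ) + 3), D y = 0 := by
    rw [intervalIntegral.integral_eq_sub_of_hasDeriv_right (f := fun y => (phi (k + 1) y : ℂ) * e y)]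
    · rw [phi_neg (k + 1) (-1) (by norm_num), phi_big (k + 1) ((k:ℝ) + 3) (by push_cast; linarith)]
      simp
    · apply Continuous.continuousOn
      have := phi_cont k
      fun_prop
    · intro y _
      exact (phi_right k y).ofReal_comp.mul (hed y).hasDerivWithinAt
    · exact hDint.intervalIntegrable
  rw [intervalIntegral.integral_eq_integral_of_support_subset] at h0
  · rw [hDe, integral_sub i12 (i3.const_mul _), integral_sub i1 i2, integral_const_mul] at h0
    have := EE_shift k w 1
    rw [this] at h0
    have a1 : ∫ y : ℝ, (phi k y : ℂ) * e y = EE k w := rfl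
    have a2 : ∫ y : ℝ, (phi (k + 1) y : ℂ) * e y = EE (k + 1) w := rfl
    rw [a1, a2] at h0
    simp only [Complex.ofReal_one, mul_one] at h0
    linear_combination -h0
  · intro y hy
    by_contra hcon
    apply hy
    simp only [hD]
    by_cases hy0 : y ≤ -1
    · rw [phi_neg k y (by linarith), phi_neg k (y - 1) (by linarith), phi_neg (k + 1) y (by linarith)]; simp
    · have : (k:ℝ) + 3 < y := by
        by_contra h3
        exact hcon ⟨by linarith, by linarith⟩
      rw [phi_big k y (by linarith), phi_big k (y - 1) (by linarith), phi_big (k + 1) y (by push_cast; linarith)]; simp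

lemma one_sub_exp (w : ℝ) :
    1 - Complex.exp (-(Complex.I * w)) = Complex.I * w * (Complex.exp (-(Complex.I * (w / 2))) * (sincf (w / 2) : ℂ)) := by
  by_cases hw : w = 0
  · subst hw; simp
  have h2 : w / 2 ≠ 0 := by positivity
  have hwc : (w : ℂ) ≠ 0 := by exact_mod_cast hw
  rw [sincf, if_neg h2]
  push_cast
  rw [Complex.sin, show -(Complex.I * (w:ℂ)) = -(Complex.I * (w / 2)) + -(Complex.I * (w / 2)) by ring, Complex.exp_add]
  have : Complex.exp (-(Complex.I * (w / 2))) * Complex.exp (Complex.I * (w / 2)) = 1 := by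
    rw [← Complex.exp_add]; simp
  rw [show (w : ℂ) / 2 * Complex.I = Complex.I * (w / 2) by ring,
    show -((w : ℂ) / 2) * Complex.I = -(Complex.I * (w / 2)) by ring]
  generalize Complex.exp (-(Complex.I * (w / 2))) = a at *
  generalize Complex.exp (Complex.I * (w / 2)) = b at *
  field_simp
  linear_combination (-1) * this + (a * b - a^2) * Complex.I_sq

lemma EE_eq (k : ℕ) (w : ℝ) (hw : w ≠ 0) :
    EE k w = (Complex.exp (-(Complex.I * (w / 2))) * (sincf (w / 2) : ℂ)) ^ (k + 1) := by
  have hwc : Complex.I * (w : ℂ) ≠ 0 := by simp [hw]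
  induction k with
  | zero =>
    apply mul_left_cancel₀ hwc
    rw [EE_zero w hw, one_sub_exp]; simp
  | succ k ih =>
    apply mul_left_cancel₀ hwc
    rw [EE_succ, ih, one_sub_exp]; ring

noncomputable def gg (q : ℕ) (y : ℝ) : ℝ := phi q y - 2 * phi q (y - 1) + phi q (y - 2)

lemma gg_int (q : ℕ) : Integrable (gg q) :=
  ((phi_integrable q).sub (((phi_integrable q).comp_sub_right 1).const_mul 2)).add
    ((phi_integrable q).comp_sub_right 2)

lemma gg_meas (q : ℕ) : Measurable (gg q) := by
  have h := phi_meas q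
  have h1 : Measurable fun y : ℝ => phi q (y - 1) := h.comp (by fun_prop)
  have h2 : Measurable fun y : ℝ => phi q (y - 2) := h.comp (by fun_prop)
  unfold gg
  fun_prop

lemma gg_hat (q : ℕ) (w : ℝ) (hw : w ≠ 0) :
    ∫ y : ℝ, (gg q y : ℂ) * Complex.exp (-(Complex.I * w * y)) =
      -(w : ℂ) ^ 2 * (sincf (w / 2) : ℂ) ^ (q + 3) * Complex.exp (-(Complex.I * w * ((q + 3) / 2))) := by
  have i1 := mul_e_int (phi_integrable q) w
  have i2 := mul_e_int ((phi_integrable q).comp_sub_right 1) w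
  have i3 := mul_e_int ((phi_integrable q).comp_sub_right 2) w
  have : ∀ y : ℝ, (gg q y : ℂ) * Complex.exp (-(Complex.I * w * y)) =
    ((phi q y : ℂ) * Complex.exp (-(Complex.I * w * y)) - 2 * ((phi q (y - 1) : ℂ) * Complex.exp (-(Complex.I * w * y))))
      + (phi q (y - 2) : ℂ) * Complex.exp (-(Complex.I * w * y)) := by
    intro y; unfold gg; push_cast; ring
  simp only [this]
  have i12 : Integrable (fun y : ℝ => (phi q y : ℂ) * Complex.exp (-(Complex.I * w * y)) - 2 * ((phi q (y - 1) : ℂ) * Complex.exp (-(Complex.I * w * y)))) :=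
    i1.sub (i2.const_mul 2)
  rw [integral_add i12 i3, integral_sub i1 (i2.const_mul 2), integral_const_mul,
    EE_shift, EE_shift]
  have a1 : ∫ y : ℝ, (phi q y : ℂ) * Complex.exp (-(Complex.I * w * y)) = EE q w := rfl
  rw [a1]
  have e2 : Complex.exp (-(Complex.I * w * ((2:ℝ):ℂ))) = Complex.exp (-(Complex.I * w)) ^ 2 := by
    rw [← Complex.exp_nat_mul]; congr 1; push_cast; ring
  have e1 : Complex.exp (-(Complex.I * w * ((1:ℝ):ℂ))) = Complex.exp (-(Complex.I * w)) := by simp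
  rw [e1, e2]
  have : EE q w - 2 * (Complex.exp (-(Complex.I * w)) * EE q w) + Complex.exp (-(Complex.I * w)) ^ 2 * EE q w =
      (1 - Complex.exp (-(Complex.I * w))) ^ 2 * EE q w := by ring
  rw [this, one_sub_exp, EE_eq q w hw]
  have e3 : Complex.exp (-(Complex.I * w * ((q + 3) / 2))) = Complex.exp (-(Complex.I * (w / 2))) ^ (q + 3) := by
    rw [← Complex.exp_nat_mul]; congr 1; push_cast; ring
  rw [e3]
  generalize Complex.exp (-(Complex.I * (w / 2))) = a
  generalize (sincf (w / 2) : ℂ) = b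
  linear_combination (w:ℂ)^2 * (a * b)^(q+3) * Complex.I_sq

lemma K_eq (q : ℕ) (x w : ℝ) (hw : w ≠ 0) :
    ∫ v in Set.Ioi (0:ℝ), Real.cos (w * v) * (gg q (x - v) + gg q (x + v)) =
      -(w ^ 2 * sincf (w / 2) ^ (q + 3) * Real.cos (w * (x - (q + 3) / 2))) := by
  have hb : ∀ f : ℝ → ℝ, Integrable f → Integrable fun v => Real.cos (w * v) * f v := by
    intro f hf
    refine hf.bdd_mul (c := 1) (Continuous.aestronglyMeasurable (by fun_prop)) ?_
    exact Filter.Eventually.of_forall fun v => Real.abs_cos_le_one _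
  have i1 : Integrable fun v => Real.cos (w * v) * gg q (x - v) := hb _ ((gg_int q).comp_sub_left x)
  have i2 : Integrable fun v => Real.cos (w * v) * gg q (x + v) := hb _ ((gg_int q).comp_add_left x)
  have s1 : ∫ v in Set.Ioi (0:ℝ), Real.cos (w * v) * (gg q (x - v) + gg q (x + v)) =
      ∫ v, Real.cos (w * v) * gg q (x - v) := by
    simp only [mul_add]
    rw [integral_add i1.integrableOn i2.integrableOn, ← intervalIntegral.integral_Iic_add_Ioi
      (b := 0) i1.integrableOn i1.integrableOn, add_comm]
    congr 1
    have := integral_comp_neg_Ioi (0:ℝ) (fun v => Real.cos (w * v) * gg q (x - v))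
    rw [neg_zero] at this
    rw [← this]
    congr 1; funext v
    rw [mul_neg, Real.cos_neg, sub_neg_eq_add]
  rw [s1, ← integral_sub_left_eq_self (fun v => Real.cos (w * v) * gg q (x - v)) volume x]
  have h3 := gg_hat q w hw
  have h4 := congrArg (fun z => (Complex.exp (Complex.I * w * x) * z).re) h3
  rw [← integral_const_mul] at h4
  have h5 := integral_re ((mul_e_int (gg_int q) w).const_mul (Complex.exp (Complex.I * w * x)))
  simp only [RCLike.re_to_complex] at h5
  rw [← h5] at h4
  have l : ∀ y : ℝ, Real.cos (w * (x - y)) * gg q (x - (x - y)) =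
      (Complex.exp (Complex.I * w * x) * ((gg q y : ℂ) * Complex.exp (-(Complex.I * w * y)))).re := by
    intro y
    rw [mul_left_comm, ← Complex.exp_add, show Complex.I * w * x + -(Complex.I * w * y) = ((w * (x - y) : ℝ) : ℂ) * Complex.I by push_cast; ring,
      Complex.re_ofReal_mul, Complex.exp_ofReal_mul_I_re, sub_sub_cancel, mul_comm]
  simp only [l]
  rw [h4]
  rw [mul_left_comm, ← Complex.exp_add, show Complex.I * w * x + -(Complex.I * w * ((q + 3) / 2)) = ((w * (x - (q + 3) / 2) : ℝ) : ℂ) * Complex.I by push_cast; ring]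
  rw [show -(w : ℂ) ^ 2 * (sincf (w / 2) : ℂ) ^ (q + 3) = ((-(w ^ 2 * sincf (w / 2) ^ (q + 3)) : ℝ) : ℂ) by push_cast; ring,
    Complex.re_ofReal_mul, Complex.exp_ofReal_mul_I_re]
  ring

lemma sincf_eq : sincf = Real.sinc := by
  funext x; simp [sincf, Real.sinc]

noncomputable def FF (p : ℕ) (α w : ℝ) : ℝ := |w| ^ α * sincf (w / 2) ^ (p + 1)

lemma FF_int (p : ℕ) (hp : 2 ≤ p) {α : ℝ} (h1 : 1 < α) (h2 : α < 2) : Integrable (FF p α) := by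
  have hJ : Integrable (fun w : ℝ => (1 + ‖w‖) ^ (-(3 - α))) :=
    integrable_one_add_norm (by rw [Module.finrank_self]; push_cast; linarith)
  have hsm : Measurable sincf := by rw [sincf_eq]; exact Real.continuous_sinc.measurable
  refine (hJ.const_mul (2 ^ (3 - α) * 2 ^ 3)).mono' ?_ (Filter.Eventually.of_forall fun w => ?_)
  · apply Measurable.aestronglyMeasurable
    unfold FF
    have : Measurable fun w : ℝ => sincf (w / 2) := hsm.comp (by fun_prop)
    fun_prop
  · unfold FF
    have hs1 : |sincf (w / 2)| ≤ 1 := by rw [sincf_eq]; exact Real.abs_sinc_le_one _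
    rw [norm_mul, norm_pow, Real.norm_eq_abs (sincf _), Real.norm_of_nonneg (by positivity), Real.norm_eq_abs]
    have hle : |sincf (w / 2)| ^ (p + 1) ≤ |sincf (w / 2)| ^ 3 :=
      pow_le_pow_of_le_one (abs_nonneg _) hs1 (by omega)
    have hpos : 0 < 1 + |w| := by positivity
    rw [Real.rpow_neg hpos.le]
    have hx : 0 < (1 + |w|) ^ (3 - α) := by positivity
    by_cases hw : |w| ≤ 1
    · have a1 : |w| ^ α ≤ 1 := Real.rpow_le_one (abs_nonneg _) hw (by linarith)
      have a2 : (1 + |w|) ^ (3 - α) ≤ 2 ^ (3 - α) :=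
        Real.rpow_le_rpow hpos.le (by linarith) (by linarith)
      calc |w| ^ α * |sincf (w / 2)| ^ (p + 1) ≤ 1 * 1 :=
            mul_le_mul a1 (pow_le_one₀ (abs_nonneg _) hs1) (by positivity) (by norm_num)
        _ ≤ 2 ^ (3 - α) * ((1 + |w|) ^ (3 - α))⁻¹ * 2 ^ 3 := by
            have : 1 ≤ 2 ^ (3 - α) * ((1 + |w|) ^ (3 - α))⁻¹ := by
              rw [← div_eq_mul_inv, one_le_div hx]; exact a2
            linarith
        _ = _ := by ring
    · push Not at hw
      have hw0 : 0 < |w| := by linarith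
      have hwne : w / 2 ≠ 0 := by
        have := abs_pos.1 hw0
        positivity
      have b1 : |sincf (w / 2)| ≤ 2 / |w| := by
        rw [sincf, if_neg hwne, abs_div, abs_div, abs_two, div_div_eq_mul_div]
        gcongr
        have := Real.abs_sin_le_one (w / 2)
        linarith
      have b2 : (1 + |w|) ^ (3 - α) ≤ 2 ^ (3 - α) * |w| ^ (3 - α) := by
        rw [← Real.mul_rpow (by norm_num) hw0.le]
        exact Real.rpow_le_rpow hpos.le (by linarith) (by linarith)
      have b3 : |w| ^ α * |w| ^ (3 - α) = |w| ^ 3 := by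
        rw [← Real.rpow_add hw0, ← Real.rpow_natCast]; congr 1; push_cast; ring
      calc |w| ^ α * |sincf (w / 2)| ^ (p + 1) ≤ |w| ^ α * (2 / |w|) ^ 3 := by
            gcongr
            exact hle.trans (pow_le_pow_left₀ (abs_nonneg _) b1 3)
        _ = 2 ^ 3 / |w| ^ (3 - α) := by
            rw [div_pow, ← b3]
            have : 0 < |w| ^ α := by positivity
            have : 0 < |w| ^ (3 - α) := by positivity
            field_simp
        _ ≤ 2 ^ (3 - α) * 2 ^ 3 * ((1 + |w|) ^ (3 - α))⁻¹ := by
            rw [← div_eq_mul_inv, div_le_div_iff₀ (by positivity) hx]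
            nlinarith

lemma period_sum {E : Type*} [NormedAddCommGroup E] [NormedSpace ℝ E] [CompleteSpace E] {h : ℝ → E} (hh : Integrable h) :
    HasSum (fun l : ℤ => ∫ θ in (-Real.pi)..Real.pi, h (θ + 2 * l * Real.pi)) (∫ w, h w) := by
  have hpi := Real.pi_pos
  have hc : (2 * Real.pi) ≠ 0 := by positivity
  have h2 : Integrable (fun x => h (2 * Real.pi * x)) := hh.comp_mul_left' hc
  have := (h2.hasSum_intervalIntegral (-(1/2))).const_smul (2 * Real.pi)
  rw [Measure.integral_comp_mul_left, abs_of_pos (by positivity), smul_smul, mul_inv_cancel₀ hc, one_smul] at this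
  convert this using 1
  funext l
  rw [intervalIntegral.smul_integral_comp_mul_left, intervalIntegral.integral_comp_add_right]
  congr 1 <;> ring

lemma coeff_eq (p : ℕ) (hp : 2 ≤ p) {α : ℝ} (h1 : 1 < α) (h2 : α < 2) (k : ℤ) :
    (fourierCoeffSym (fSymbol p α) k).re = 1 / (2 * Real.pi) * ∫ w, FF p α w * Real.cos (w * k) := by
  have hpi := Real.pi_pos
  set h : ℝ → ℂ := fun w => (FF p α w : ℂ) * Complex.exp (-(Complex.I * (k : ℝ) * w)) with hdef
  have hh : Integrable h := mul_e_int (FF_int p hp h1 h2) k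
  have hle : -Real.pi ≤ Real.pi := by linarith
  have key := hasSum_integral_of_summable_integral_norm (μ := volume.restrict (Set.Ioc (-Real.pi) Real.pi))
    (F := fun (l : ℤ) θ => h (θ + 2 * l * Real.pi)) (fun l => (hh.comp_add_right _).integrableOn) (by
      have := (period_sum hh.norm).summable
      simpa only [intervalIntegral.integral_of_le hle] using this)
  have k2 := period_sum hh
  simp only [intervalIntegral.integral_of_le hle] at k2
  have e := key.unique k2
  have e2 : ∀ θ : ℝ, ∑' l : ℤ, h (θ + 2 * l * Real.pi) =
      (fSymbol p α θ : ℂ) * Complex.exp (-(Complex.I * (k : ℂ) * (θ : ℂ))) := by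
    intro θ
    rw [fSymbol, Complex.ofReal_tsum, ← tsum_mul_right]
    congr 1; funext l
    simp only [hdef, FF]
    rw [show (θ + 2 * (l:ℝ) * Real.pi) / 2 = θ / 2 + l * Real.pi by ring]
    congr 1
    rw [Complex.exp_eq_exp_iff_exists_int]
    refine ⟨-(k * l), ?_⟩
    push_cast; ring
  simp only [e2] at e
  rw [fourierCoeffSym, intervalIntegral.integral_of_le hle, e, Complex.re_ofReal_mul]
  congr 1
  have := integral_re hh
  simp only [RCLike.re_to_complex] at this
  rw [← this]
  congr 1; funext w
  simp only [hdef]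
  rw [Complex.re_ofReal_mul, show -(Complex.I * ((k : ℝ) : ℂ) * w) = ((-(w * k) : ℝ) : ℂ) * Complex.I by push_cast; ring,
    Complex.exp_ofReal_mul_I_re, Real.cos_neg]

lemma HH_sum (α : ℝ) (h2 : α < 2) (q : ℕ) (t : ℝ) :
    (HH α 1 q t - 2 * HH α 1 q (t - 1) + HH α 1 q (t - 2)) +
    (HH α (-1) q t - 2 * HH α (-1) q (t - 1) + HH α (-1) q (t - 2)) =
    ∫ v in Set.Ioi (0:ℝ), v ^ (1 - α) * (gg q (t - v) + gg q (t + v)) := by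
  have one : ∀ σ : ℝ, (σ = 1 ∨ σ = -1) → HH α σ q t - 2 * HH α σ q (t - 1) + HH α σ q (t - 2) =
      ∫ v in Set.Ioi (0:ℝ), v ^ (1 - α) * gg q (t - σ * v) := by
    intro σ hσ
    have i0 := HH_integrand α h2 hσ q t
    have i1 := (HH_integrand α h2 hσ q (t - 1)).const_mul 2
    have i2 := HH_integrand α h2 hσ q (t - 2)
    have i01 : IntegrableOn (fun v => v ^ (1 - α) * phi q (t - σ * v) - 2 * (v ^ (1 - α) * phi q (t - 1 - σ * v))) (Set.Ioi 0) := i0.sub i1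
    unfold HH
    rw [← integral_const_mul, ← integral_sub i0 i1, ← integral_add i01 i2]
    congr 1; funext v
    simp only [gg]
    rw [show t - 1 - σ * v = t - σ * v - 1 by ring, show t - 2 - σ * v = t - σ * v - 2 by ring]; ring
  have oint : ∀ σ : ℝ, (σ = 1 ∨ σ = -1) → IntegrableOn (fun v => v ^ (1 - α) * gg q (t - σ * v)) (Set.Ioi 0) := by
    intro σ hσ
    have i0 := HH_integrand α h2 hσ q t
    have i1 := (HH_integrand α h2 hσ q (t - 1)).const_mul 2
    have i2 := HH_integrand α h2 hσ q (t - 2)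
    refine ((i0.sub i1).add i2).congr (Filter.Eventually.of_forall fun v => ?_)
    simp only [gg, Pi.sub_apply, Pi.add_apply]
    rw [show t - 1 - σ * v = t - σ * v - 1 by ring, show t - 2 - σ * v = t - σ * v - 2 by ring]; ring
  rw [one 1 (Or.inl rfl), one (-1) (Or.inr rfl), ← integral_add (oint 1 (Or.inl rfl)) (oint (-1) (Or.inr rfl))]
  congr 1; funext v
  rw [one_mul, neg_one_mul, sub_neg_eq_add]; ring

lemma good_entry (p n i j : ℕ) (hp : 2 ≤ p) (α : ℝ) (h1 : 1 < α) (h2 : α < 2) (hi : p + 1 ≤ i)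
    (hi2 : i ≤ n) (hj : p + 1 ≤ j) (hj2 : j ≤ n) :
    (n : ℝ) ^ (-α) * (1 / (2 * Real.cos (Real.pi * α / 2)) *
      (RLD0x α (bspline p n p j) (greville p n i) + RLDx1 α (bspline p n p j) (greville p n i))) =
      (fourierCoeffSym (fSymbol p α) ((i : ℤ) - (j : ℤ))).re := by
  obtain ⟨q, rfl⟩ : ∃ q, p = q + 2 := ⟨p - 2, by omega⟩
  have hn' : (0 : ℝ) < n := by
    have : 0 < n := by omega
    positivity
  set t : ℝ := ((i : ℝ) - j) + (((q + 2 : ℕ) : ℝ) + 1) / 2 with ht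
  obtain ⟨eL, eR⟩ := entry_eq (q + 2) n i j hp α h2 hi hi2 hj hj2 t ht
  rw [eL, eR, coeff_eq (q + 2) hp h1 h2, ← mul_add, ← mul_add, Nat.add_sub_cancel, HH_sum α h2]
  have hnn : (n : ℝ) ^ (-α) * (n : ℝ) ^ α = 1 := by
    rw [← Real.rpow_add hn']; simp
  obtain ⟨C, hC0, hC⟩ := phi_bdd q
  have hgb : ∀ y, |gg q y| ≤ 4 * C := by
    intro y
    unfold gg
    have a := abs_le.1 (hC y)
    have b := abs_le.1 (hC (y - 1))
    have c := abs_le.1 (hC (y - 2))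
    rw [abs_le]; constructor <;> linarith
  have hkt : t - ((q : ℝ) + 3) / 2 = (((i : ℤ) - (j : ℤ) : ℤ) : ℝ) := by
    rw [ht]; push_cast; ring
  have hFK : ∀ w : ℝ, |w| ^ (α - 1 - 1) * -(w ^ 2 * sincf (w / 2) ^ (q + 3) * Real.cos (w * (t - (q + 3) / 2))) =
      -(FF (q + 2) α w * Real.cos (w * (((i : ℤ) - (j : ℤ) : ℤ) : ℝ))) := by
    intro w
    rw [hkt, FF]
    have : |w| ^ (α - 1 - 1) * w ^ 2 = |w| ^ α := by
      by_cases hw : w = 0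
      · subst hw; simp; rw [Real.zero_rpow (by linarith)]
      · have hw0 : 0 < |w| := abs_pos.2 hw
        rw [← sq_abs w, ← Real.rpow_natCast, ← Real.rpow_add hw0]; congr 1; push_cast; ring
    rw [← this]; ring
  have hsm : Measurable sincf := by rw [sincf_eq]; exact Real.continuous_sinc.measurable
  have hFint : Integrable (fun w => FF (q + 2) α w * Real.cos (w * (((i : ℤ) - (j : ℤ) : ℤ) : ℝ))) := by
    refine (FF_int (q + 2) hp h1 h2).mul_bdd (c := 1) (Continuous.aestronglyMeasurable (by fun_prop)) ?_
    exact Filter.Eventually.of_forall fun v => Real.abs_cos_le_one _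
  have R := riesz (s := α - 1) (by linarith) (by linarith)
    (G := fun v => gg q (t - v) + gg q (t + v)) (C := 8 * C) (M := |t| + q + 3)
    (K := fun w => -(w ^ 2 * sincf (w / 2) ^ (q + 3) * Real.cos (w * (t - (q + 3) / 2))))
    (by
      have a : Measurable fun v => gg q (t - v) := (gg_meas q).comp (by fun_prop)
      have b : Measurable fun v => gg q (t + v) := (gg_meas q).comp (by fun_prop)
      exact a.add b)
    (fun v => by
      have a := abs_le.1 (hgb (t - v))
      have b := abs_le.1 (hgb (t + v))
      rw [abs_le]; constructor <;> linarith)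
    (fun v hv => by
      have hq : (0:ℝ) ≤ q := Nat.cast_nonneg q
      have a := le_abs_self t
      have b := neg_abs_le t
      simp only [gg]
      rw [phi_neg q (t - v) (by linarith), phi_neg q (t - v - 1) (by linarith), phi_neg q (t - v - 2) (by linarith),
        phi_big q (t + v) (by linarith), phi_big q (t + v - 1) (by linarith), phi_big q (t + v - 2) (by linarith)]
      norm_num)
    (by
      have : Measurable fun w : ℝ => sincf (w / 2) := hsm.comp (by fun_prop)
      fun_prop)
    (fun w hw => K_eq q t w hw)
    (by simp only [hFK]; exact hFint.neg)
  simp only [hFK] at R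
  rw [integral_neg, show -(α - 1) = 1 - α by ring, show 1 - (α - 1) = 2 - α by ring] at R
  have g4 := Real.Gamma_pos_of_pos (show 0 < (α - 1) / 2 by linarith)
  have ce := const_eq h1 h2
  generalize (∫ w, FF (q + 2) α w * Real.cos (w * (((i : ℤ) - (j : ℤ) : ℤ) : ℝ))) = J at *
  generalize (∫ v in Set.Ioi (0:ℝ), v ^ (1 - α) * (gg q (t - v) + gg q (t + v))) = I at *
  have hI : I = (1 / (2 * √Real.pi) * (2 ^ (2 - α) * Real.Gamma ((2 - α) / 2))) / Real.Gamma ((α - 1) / 2) * -J := by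
    rw [div_mul_eq_mul_div, eq_div_iff g4.ne', ← R, mul_comm]
  calc _ = ((n : ℝ) ^ (-α) * (n : ℝ) ^ α) * (1 / (2 * Real.cos (Real.pi * α / 2)) * (1 / Real.Gamma (2 - α)) * I) := by ring
    _ = _ := by rw [hnn, hI, one_mul, ← mul_assoc, ce]; ring

lemma mrank_add_le {N : ℕ} (A B : Matrix (Fin N) (Fin N) ℝ) : (A + B).rank ≤ A.rank + B.rank := by
  unfold Matrix.rank
  rw [Matrix.mulVecLin_add]
  refine le_trans (Submodule.finrank_mono (t := A.mulVecLin.range ⊔ B.mulVecLin.range) ?_)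
    (Submodule.finrank_add_le_finrank_add_finrank _ _)
  rintro _ ⟨x, rfl⟩
  exact Submodule.add_mem_sup ⟨x, rfl⟩ ⟨x, rfl⟩

lemma rank_aux {N : ℕ} (M : Matrix (Fin N) (Fin N) ℝ) (S : Finset (Fin N))
    (h : ∀ i j, i ∉ S → j ∉ S → M i j = 0) : M.rank ≤ 2 * S.card := by
  classical
  set d : Matrix (Fin N) (Fin N) ℝ := Matrix.diagonal fun i => if i ∈ S then 1 else 0 with hd
  have hrd : d.rank ≤ S.card := by
    rw [hd, Matrix.rank_diagonal, Fintype.card_subtype]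
    apply Finset.card_le_card
    intro i; simp
  have hM : M = d * M + (M - d * M) * d := by
    ext i j
    simp only [hd, Matrix.add_apply, Matrix.diagonal_mul, Matrix.mul_diagonal, Matrix.sub_apply]
    by_cases hi : i ∈ S <;> by_cases hj : j ∈ S <;> simp [hi, hj]
    exact h i j hi hj
  rw [hM]
  calc _ ≤ (d * M).rank + ((M - d * M) * d).rank := mrank_add_le _ _
    _ ≤ d.rank + d.rank := add_le_add (Matrix.rank_mul_le_left _ _) (Matrix.rank_mul_le_right _ _)
    _ ≤ _ := by omega

lemma card_aux (N a b : ℕ) :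
    (Finset.univ.filter fun i : Fin N => (i : ℕ) < a ∨ b ≤ (i : ℕ)).card ≤ a + (N - b) := by
  have : (Finset.univ.filter fun i : Fin N => (i : ℕ) < a ∨ b ≤ (i : ℕ)).card ≤ (Finset.range a ∪ Finset.Ico b N).card := by
    apply Finset.card_le_card_of_injOn (fun i : Fin N => (i : ℕ))
    · intro i hi
      simp only [Finset.coe_filter, Finset.mem_univ, true_and, Set.mem_setOf_eq] at hi
      simp only [Finset.coe_union, Set.mem_union, Finset.mem_coe, Finset.mem_range, Finset.mem_Ico]
      have := i.2
      omega
    · intro i _ j _ hij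
      exact Fin.ext hij
  refine this.trans ((Finset.card_union_le _ _).trans ?_)
  simp

theorem stmt17 (p n : ℕ) (hp : 2 ≤ p) (α : ℝ) (h1 : 1 < α) (h2 : α < 2)
    (hn : p + 1 ≤ n) :
    (Rmat p n α).rank ≤ 4 * (p - 1) := by
  have h := rank_aux (Rmat p n α)
    (Finset.univ.filter fun i : Fin (n + p - 2) => (i : ℕ) < p - 1 ∨ n - 1 ≤ (i : ℕ)) (by
      intro i j hi hj
      simp only [Finset.mem_filter, Finset.mem_univ, true_and] at hi hj
      have := good_entry p n ((i : ℕ) + 2) ((j : ℕ) + 2) hp α h1 h2 (by omega) (by omega) (by omega) (by omega)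
      simp only [Rmat, Amat, ALmat, ARmat, toeplitzMat, Matrix.sub_apply, Matrix.smul_apply, Matrix.add_apply,
        Matrix.of_apply, smul_eq_mul]
      rw [this, sub_eq_zero]
      congr 2
      push_cast; ring)
  have hc := card_aux (n + p - 2) (p - 1) (n - 1)
  omega
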